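/- arXiv:1612.06713 — 2 statements merged into one kernel-verified Lean document; each statement's English description precedes it below -/
import Mathlib

section
/- Let 𝓛 = (L_1, …, L_m) be an m-tuple of Z_K-lattices in V (m ≥ 1). If the genus of the single lattice L_1 contains only finitely many isometry classes, then the genus of the tuple 𝓛 contains only finitely many isometry classes; in particular the class number of 𝓛 is finite. -/
/-
STATEMENT 2: Let 𝓛 = (L_1, …, L_m) be an m-tuple of Z_K-lattices in V (m ≥ 1).
If the genus of the single lattice L_1 contains only finitely many isometry
classes, then the genus of the tuple 𝓛 contains only finitely many isometry
classes; in particular the class number of 𝓛 is finite.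
-/

set_option maxHeartbeats 1000000
set_option synthInstance.maxHeartbeats 1000000

open NumberField IsDedekindDomain TensorProduct
open scoped nonZeroDivisors

noncomputable instance adicSMulCommClass {K : Type*} [Field K] [NumberField K]
    (v : HeightOneSpectrum (𝓞 K)) :
    SMulCommClass K (v.adicCompletion K) (v.adicCompletion K) :=
  Algebra.to_smulCommClass

variable {K : Type*} [Field K] [NumberField K]
variable {V : Type*} [AddCommGroup V] [Module K V]
  [Module (𝓞 K) V] [IsScalarTower (𝓞 K) K V]

/-- The `Z_{K_p}`-submodule of `V_p = K_p ⊗ V` generated by (the image of) a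
`Z_K`-submodule `N` of `V`. -/
noncomputable def latCompletion (v : HeightOneSpectrum (𝓞 K)) (N : Submodule (𝓞 K) V) :
    Submodule ((v.adicCompletionIntegers K).toSubring) ((v.adicCompletion K) ⊗[K] V) :=
  Submodule.span _ ((fun x : V => (1 : v.adicCompletion K) ⊗ₜ[K] x) '' (N : Set V))

/-- `N` is a `Z_K`-lattice in `V`: a finitely generated `Z_K`-submodule
containing a `K`-basis of `V`. -/
def IsZLat (N : Submodule (𝓞 K) V) : Prop :=
  N.FG ∧ Submodule.span K (N : Set V) = ⊤

/-- Two tuples of `Z_K`-lattices are in the same genus: for every maximal ideal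
(height-one prime) `v` of `Z_K` there is an isometry of the completed space
`(V_v, Φ_v)` carrying the completions of the members of one tuple to those of
the other. -/
def SameGenus (Φ : LinearMap.BilinForm K V) {ι : Type*}
    (L L' : ι → Submodule (𝓞 K) V) : Prop :=
  ∀ v : HeightOneSpectrum (𝓞 K),
    ∃ g : ((v.adicCompletion K) ⊗[K] V) ≃ₗ[v.adicCompletion K]
        ((v.adicCompletion K) ⊗[K] V),
      (∀ x y, Φ.baseChange (v.adicCompletion K) (g x) (g y) =
        Φ.baseChange (v.adicCompletion K) x y) ∧
      ∀ i, ⇑g '' ((latCompletion v (L i) : Set _)) = (latCompletion v (L' i) : Set _)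

/-- Two tuples of `Z_K`-lattices are isometric: some isometry of `(V, Φ)` maps
each member of the first tuple onto the corresponding member of the second. -/
def IsIsom (Φ : LinearMap.BilinForm K V) {ι : Type*}
    (L L' : ι → Submodule (𝓞 K) V) : Prop :=
  ∃ g : V ≃ₗ[K] V, (∀ x y, Φ (g x) (g y) = Φ x y) ∧
    ∀ i, ⇑g '' ((L i : Set V)) = ((L' i : Set V))

/-- The genus of a tuple of lattices, as a set of tuples of lattices. -/
def genusSet (Φ : LinearMap.BilinForm K V) {ι : Type*}
    (L : ι → Submodule (𝓞 K) V) : Set (ι → Submodule (𝓞 K) V) :=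
  {L' | (∀ i, IsZLat (L' i)) ∧ SameGenus Φ L L'}

/-- The class number of a tuple of lattices: the number of isometry classes in
its genus. -/
noncomputable def classNumber (Φ : LinearMap.BilinForm K V) {ι : Type*}
    (L : ι → Submodule (𝓞 K) V) : ℕ :=
  Nat.card (Quot (fun X Y : genusSet Φ L => IsIsom Φ X.1 Y.1))

theorem exists_smul_mem_of_span (N : Submodule (𝓞 K) V)
    (hN : Submodule.span K (N : Set V) = ⊤) (x : V) :
    ∃ d : 𝓞 K, d ≠ 0 ∧ d • x ∈ N := by
  have hx : x ∈ Submodule.span K (N : Set V) := by rw [hN]; trivial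
  induction hx using Submodule.span_induction with
  | mem x h => exact ⟨1, one_ne_zero, by simpa using h⟩
  | zero => exact ⟨1, one_ne_zero, by simp⟩
  | add x y _ _ hx hy =>
    obtain ⟨a, ha, hax⟩ := hx
    obtain ⟨b, hb, hby⟩ := hy
    refine ⟨a * b, mul_ne_zero ha hb, ?_⟩
    rw [smul_add]
    refine N.add_mem ?_ ?_
    · rw [mul_comm, mul_smul]; exact N.smul_mem _ hax
    · rw [mul_smul]; exact N.smul_mem _ hby
  | smul c x _ hx =>
    obtain ⟨a, ha, hax⟩ := hx
    obtain ⟨⟨n, s⟩, hs⟩ := IsLocalization.surj (nonZeroDivisors (𝓞 K)) c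
    refine ⟨s * a, mul_ne_zero (nonZeroDivisors.ne_zero s.2) ha, ?_⟩
    have : ((s : 𝓞 K) * a) • c • x = n • a • x := by
      rw [← IsScalarTower.algebraMap_smul K ((s : 𝓞 K) * a) (c • x),
        ← IsScalarTower.algebraMap_smul K n (a • x), ← IsScalarTower.algebraMap_smul K a x,
        smul_smul, smul_smul]
      congr 1
      simp only at hs
      rw [← hs, map_mul]; ring
    rw [this]
    exact N.smul_mem _ hax

theorem exists_smul_mem_of_fg (M N : Submodule (𝓞 K) V) (hM : M.FG)
    (hN : Submodule.span K (N : Set V) = ⊤) :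
    ∃ d : 𝓞 K, d ≠ 0 ∧ ∀ x ∈ M, d • x ∈ N := by
  induction M, hM using Submodule.fg_induction with
  | singleton x =>
    obtain ⟨d, hd, hx⟩ := exists_smul_mem_of_span N hN x
    refine ⟨d, hd, fun y hy => ?_⟩
    obtain ⟨c, rfl⟩ := Submodule.mem_span_singleton.1 hy
    rw [smul_comm]; exact N.smul_mem _ hx
  | sup A B _ _ hA hB =>
    obtain ⟨a, ha, hax⟩ := hA
    obtain ⟨b, hb, hby⟩ := hB
    refine ⟨a * b, mul_ne_zero ha hb, fun z hz => ?_⟩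
    obtain ⟨x, hx, y, hy, rfl⟩ := Submodule.mem_sup.1 hz
    rw [smul_add]
    refine N.add_mem ?_ ?_
    · rw [mul_comm, mul_smul]; exact N.smul_mem _ (hax x hx)
    · rw [mul_smul]; exact N.smul_mem _ (hby y hy)

theorem exists_approx (v : HeightOneSpectrum (𝓞 K)) (c : v.adicCompletion K)
    (hc : c ∈ v.adicCompletionIntegers K) (d : 𝓞 K) (hd : d ≠ 0) :
    ∃ (b : 𝓞 K) (c' : v.adicCompletion K), c' ∈ v.adicCompletionIntegers K ∧
      c = algebraMap K _ (algebraMap (𝓞 K) K b) +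
        c' * algebraMap K _ (algebraMap (𝓞 K) K d) := by
  have hval : ∀ k : K, Valued.v (algebraMap K (v.adicCompletion K) k) = v.valuation K k :=
    fun k => v.valuedAdicCompletion_eq_valuation' k
  have hdK : (algebraMap (𝓞 K) K d) ≠ 0 := by simpa using hd
  have hdv : v.valuation K (algebraMap (𝓞 K) K d) ≠ 0 := (Valuation.ne_zero_iff _).2 hdK
  have hd1 : v.valuation K (algebraMap (𝓞 K) K d) ≤ 1 := v.valuation_le_one d
  have hdne : algebraMap K (v.adicCompletion K) (algebraMap (𝓞 K) K d) ≠ 0 := by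
    simpa using hd
  have hdv' : Valued.v (algebraMap K (v.adicCompletion K) (algebraMap (𝓞 K) K d)) ≠ 0 := by
    rwa [hval]
  have hcl := v.denseRange_algebraMap K c
  obtain ⟨_, hk, ⟨k, rfl⟩⟩ : ∃ y, Valued.v (y - c) <
      v.valuation K (algebraMap (𝓞 K) K d) ∧
      y ∈ Set.range (algebraMap K (v.adicCompletion K)) := by
    rw [mem_closure_iff_nhds] at hcl
    obtain ⟨y, hy1, hy2⟩ := hcl {y | Valued.v (y - c) <
      Valued.v (algebraMap K (v.adicCompletion K) (algebraMap (𝓞 K) K d))} (by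
      rw [Valued.mem_nhds]
      refine ⟨Units.mk0 (Valued.v.restrict
        (algebraMap K (v.adicCompletion K) (algebraMap (𝓞 K) K d))) (by simpa using hd), ?_⟩
      intro y hy
      exact (Valuation.restrict_lt_iff _).mp hy)
    exact ⟨y, by rw [← hval]; exact hy1, hy2⟩
  have hc1 : Valued.v c ≤ 1 := hc
  have hk1 : v.valuation K k ≤ 1 := by
    rw [← hval]
    have : algebraMap K (v.adicCompletion K) k = (algebraMap K (v.adicCompletion K) k - c) + c := by
      ring
    rw [this]
    exact (Valuation.map_add _ _ _).trans (max_le (hk.le.trans hd1) hc1)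
  obtain ⟨b, hb⟩ := v.exists_valuation_sub_lt_of_integer hk1 (Units.mk0 _ hdv)
  refine ⟨b, (c - algebraMap K _ (algebraMap (𝓞 K) K b)) /
    algebraMap K _ (algebraMap (𝓞 K) K d), ?_, ?_⟩
  · rw [HeightOneSpectrum.mem_adicCompletionIntegers, map_div₀]
    refine div_le_one_of_le₀ ?_ zero_le
    rw [hval, ← Valuation.map_neg]
    have : -(c - algebraMap K (v.adicCompletion K) (algebraMap (𝓞 K) K b)) =
      (algebraMap K (v.adicCompletion K) k - c) +
        algebraMap K (v.adicCompletion K) (algebraMap (𝓞 K) K b - k) := by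
      rw [map_sub]; ring
    rw [this]
    refine (Valuation.map_add _ _ _).trans (max_le hk.le ?_)
    rw [hval]; exact hb.le
  · rw [div_mul_cancel₀ _ hdne]; ring

theorem mem_of_forall_latCompletion [FiniteDimensional K V] (N : Submodule (𝓞 K) V)
    (hN : IsZLat N) (x : V)
    (hx : ∀ v : HeightOneSpectrum (𝓞 K),
      (1 : v.adicCompletion K) ⊗ₜ[K] x ∈ latCompletion v N) : x ∈ N := by
  obtain ⟨ι, e, he⟩ : ∃ (ι : Type _) (e : Module.Basis ι K V), ∀ j, e j ∈ N :=
    ⟨_, Module.Basis.ofSpan hN.2.ge,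
      fun j => Module.Basis.ofSpan_subset hN.2.ge ⟨j, rfl⟩⟩
  have heS : Submodule.span K ((Submodule.span (𝓞 K) (Set.range e) : Submodule (𝓞 K) V) : Set V)
      = ⊤ := by
    rw [eq_top_iff, ← e.span_eq]
    exact Submodule.span_mono Submodule.subset_span
  obtain ⟨d, hd, hdN⟩ := exists_smul_mem_of_fg N _ hN.1 heS
  let I : Ideal (𝓞 K) :=
    { carrier := {a | a • x ∈ N}
      add_mem' := fun {a b} ha hb => by
        simp only [Set.mem_ofPred_eq, add_smul] at *; exact N.add_mem ha hb
      zero_mem' := by simp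
      smul_mem' := fun c a ha => by
        simp only [Set.mem_ofPred_eq, smul_eq_mul, mul_smul] at *; exact N.smul_mem _ ha }
  by_contra hxN
  have hI : I ≠ ⊤ := fun h => hxN (by
    have : (1 : 𝓞 K) ∈ I := by rw [h]; trivial
    simpa [I] using this)
  obtain ⟨P, hP, hIP⟩ := Ideal.exists_le_maximal I hI
  have hdI : ∃ a ∈ I, a ≠ 0 := by
    obtain ⟨a, ha, hax⟩ := exists_smul_mem_of_span N hN.2 x
    exact ⟨a, hax, ha⟩
  have hPbot : P ≠ ⊥ := by
    rintro rfl
    obtain ⟨a, ha, ha0⟩ := hdI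
    exact ha0 (by simpa using hIP ha)
  let v : HeightOneSpectrum (𝓞 K) := ⟨P, hP.isPrime, hPbot⟩
  let E := Algebra.TensorProduct.basis (v.adicCompletion K) e
  have hE : ∀ (c : v.adicCompletion K) (y : V) j,
      E.repr (c ⊗ₜ y) j = c * algebraMap K _ (e.repr y j) := by
    intro c y j
    simp [E]
  have key : ∀ w ∈ latCompletion v N, ∃ y ∈ N, ∀ j,
      E.repr (w - (1 : v.adicCompletion K) ⊗ₜ y) j ∈ v.adicCompletionIntegers K := by
    intro w hw
    unfold latCompletion at hw
    induction hw using Submodule.span_induction with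
    | mem w h =>
      obtain ⟨y, hy, rfl⟩ := h
      exact ⟨y, hy, fun j => by simp⟩
    | zero => exact ⟨0, N.zero_mem, fun j => by simp⟩
    | add w w' _ _ h h' =>
      obtain ⟨y, hy, h⟩ := h
      obtain ⟨y', hy', h'⟩ := h'
      refine ⟨y + y', N.add_mem hy hy', fun j => ?_⟩
      rw [TensorProduct.tmul_add, add_sub_add_comm, map_add, Finsupp.add_apply]
      exact add_mem (h j) (h' j)
    | smul c w _ h =>
      obtain ⟨y, hy, h⟩ := h
      obtain ⟨b, c', hc', hcb⟩ := exists_approx v c.1 c.2 d hd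
      refine ⟨b • y, N.smul_mem _ hy, fun j => ?_⟩
      have hdy := hdN y hy
      rw [e.mem_span_iff_repr_mem (𝓞 K)] at hdy
      obtain ⟨r, hr⟩ := hdy j
      have h1 : c • w - (1 : v.adicCompletion K) ⊗ₜ[K] (b • y) =
          c.1 • (w - (1 : v.adicCompletion K) ⊗ₜ[K] y) + c' ⊗ₜ[K] (d • y) := by
        have h2 : c • w = c.1 • w := rfl
        rw [h2, smul_sub, TensorProduct.smul_tmul', smul_eq_mul, mul_one,
          ← IsScalarTower.algebraMap_smul K b y, ← IsScalarTower.algebraMap_smul K d y,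
          ← TensorProduct.smul_tmul, ← TensorProduct.smul_tmul, Algebra.smul_def, Algebra.smul_def,
          mul_one, mul_comm _ c']
        conv_rhs => rw [sub_add, ← TensorProduct.sub_tmul]
        rw [hcb, add_sub_cancel_right]
      rw [h1, map_add, Finsupp.add_apply, map_smul, Finsupp.smul_apply, hE, ← hr]
      exact add_mem (mul_mem c.2 (h j)) (mul_mem hc' (v.coe_mem_adicCompletionIntegers r))
  obtain ⟨y, hy, hj⟩ := key _ (hx v)
  have hz : ∀ j, ∃ s : v.asIdeal.primeCompl, ∃ n : 𝓞 K,
      e.repr (x - y) j * algebraMap (𝓞 K) K s = algebraMap (𝓞 K) K n := by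
    intro j
    have := hj j
    rw [← TensorProduct.tmul_sub, hE, one_mul, HeightOneSpectrum.mem_adicCompletionIntegers] at this
    obtain ⟨n, s, h⟩ := v.exists_primeCompl_mul_eq_of_integer (e.repr (x - y) j)
      (by rw [← v.valuedAdicCompletion_eq_valuation']; exact this)
    exact ⟨s, n, h⟩
  choose s n hs using hz
  have hfin := Module.Finite.finite_basis e
  cases nonempty_fintype ι
  classical
  have hS : (∏ j, (s j : 𝓞 K)) • x ∈ N := by
    have hx' : x = (x - y) + y := by abel
    rw [hx', smul_add]
    refine N.add_mem ?_ (N.smul_mem _ hy)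
    rw [← e.sum_repr (x - y), Finset.smul_sum]
    refine N.sum_mem fun j _ => ?_
    rw [← Finset.prod_erase_mul _ _ (Finset.mem_univ j), mul_smul]
    refine N.smul_mem _ ?_
    rw [← IsScalarTower.algebraMap_smul K (s j : 𝓞 K), smul_smul, mul_comm, hs,
      IsScalarTower.algebraMap_smul]
    exact N.smul_mem _ (he j)
  have : (∏ j, (s j : 𝓞 K)) ∈ v.asIdeal.primeCompl := prod_mem fun j _ => (s j).2
  exact this (hIP hS)

theorem smul_mem_latCompletion (v : HeightOneSpectrum (𝓞 K)) (M N : Submodule (𝓞 K) V)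
    (a : ℕ) (h : ∀ x ∈ M, a • x ∈ N) :
    ∀ w ∈ latCompletion v M, a • w ∈ latCompletion v N := by
  intro w hw
  unfold latCompletion at hw
  induction hw using Submodule.span_induction with
  | mem w hw =>
    obtain ⟨y, hy, rfl⟩ := hw
    refine Submodule.subset_span ⟨a • y, h y hy, ?_⟩
    simp only [TensorProduct.tmul_smul]
  | zero => simp
  | add w w' _ _ h h' => rw [smul_add]; exact add_mem h h'
  | smul c w _ h => rw [smul_comm]; exact Submodule.smul_mem _ _ h

theorem transfer_smul_mem [FiniteDimensional K V] (Φ : LinearMap.BilinForm K V) {ι : Type*}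
    (L L' : ι → Submodule (𝓞 K) V) (hL' : L' ∈ genusSet Φ L) (i j : ι) (a : ℕ)
    (h : ∀ x ∈ L i, a • x ∈ L j) : ∀ x ∈ L' i, a • x ∈ L' j := by
  intro x hx
  refine mem_of_forall_latCompletion _ (hL'.1 j) _ fun v => ?_
  obtain ⟨g, -, hg⟩ := hL'.2 v
  have h1 : (1 : v.adicCompletion K) ⊗ₜ[K] x ∈ (latCompletion v (L' i) : Set _) :=
    Submodule.subset_span ⟨x, hx, rfl⟩
  rw [← hg i] at h1
  obtain ⟨w, hw, hwx⟩ := h1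
  have h2 : g (a • w) ∈ (latCompletion v (L' j) : Set _) := by
    rw [← hg j]
    exact ⟨_, smul_mem_latCompletion v _ _ a h w hw, rfl⟩
  rw [map_nsmul, hwx, ← TensorProduct.tmul_smul] at h2
  exact h2

theorem finite_between (N : Submodule (𝓞 K) V) (hN : N.FG) (a : ℕ) (ha : a ≠ 0) :
    {M : Submodule (𝓞 K) V | (∀ x ∈ N, a • x ∈ M) ∧ ∀ x ∈ M, a • x ∈ N}.Finite := by
  have hV : ∀ x y : V, a • x = a • y → x = y := by
    intro x y h
    rw [← Nat.cast_smul_eq_nsmul K, ← Nat.cast_smul_eq_nsmul K] at h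
    exact smul_right_injective V (Nat.cast_ne_zero.2 ha) h
  let f : V →ₗ[𝓞 K] V := a • LinearMap.id
  have hf : ∀ x, f x = a • x := fun x => by simp [f]
  let B : Submodule (𝓞 K) V := (N.map f).map f
  let Q := N.map B.mkQ
  have hQ : Finite Q := by
    have h1 : Module.Finite (𝓞 K) Q := Module.Finite.iff_fg.2 (hN.map _)
    have h2 : Module.Finite ℤ Q := Module.Finite.trans (𝓞 K) Q
    refine Module.finite_of_fg_torsion Q ?_
    rintro ⟨_, x, hx, rfl⟩
    refine ⟨⟨(a * a : ℕ), by simp [ha]⟩, ?_⟩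
    apply Subtype.ext
    change ((a * a : ℕ) : ℤ) • B.mkQ x = 0
    rw [natCast_zsmul, ← map_nsmul, ← LinearMap.mem_ker, Submodule.ker_mkQ, mul_smul]
    exact ⟨f x, ⟨x, hx, rfl⟩, by simp [hf]⟩
  have hQs : (Q : Set (V ⧸ B)).Finite := hQ
  refine Set.Finite.of_finite_image (f := fun M => ((M.map f).map B.mkQ : Set (V ⧸ B)))
    (hQs.finite_subsets.subset ?_) ?_
  · rintro _ ⟨M, hM, rfl⟩ _ ⟨_, ⟨x, hx, rfl⟩, rfl⟩
    exact ⟨f x, by rw [hf]; exact hM.2 x hx, rfl⟩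
  · intro M hM M' hM' h
    have hB : ∀ M : Submodule (𝓞 K) V, (∀ x ∈ N, a • x ∈ M) → B ≤ M.map f := by
      rintro M hM _ ⟨_, ⟨x, hx, rfl⟩, rfl⟩
      exact ⟨f x, by rw [hf]; exact hM x hx, rfl⟩
    have h' : (M.map f).map B.mkQ = (M'.map f).map B.mkQ := SetLike.coe_injective h
    have h2 := congrArg (Submodule.comap B.mkQ) h'
    rw [Submodule.comap_map_mkQ, Submodule.comap_map_mkQ, sup_eq_right.2 (hB M hM.1),
      sup_eq_right.2 (hB M' hM'.1)] at h2
    exact Submodule.map_injective_of_injective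
      (fun x y hxy => hV x y (by rwa [hf, hf] at hxy)) h2

theorem IsIsom.symm' {Φ : LinearMap.BilinForm K V} {ι : Type*}
    {L L' : ι → Submodule (𝓞 K) V} (h : IsIsom Φ L L') : IsIsom Φ L' L := by
  obtain ⟨g, hg, h⟩ := h
  refine ⟨g.symm, fun x y => by rw [← hg]; simp, fun i => ?_⟩
  rw [← h i, Set.image_image]; simp

theorem IsIsom.trans' {Φ : LinearMap.BilinForm K V} {ι : Type*}
    {L L' L'' : ι → Submodule (𝓞 K) V} (h : IsIsom Φ L L') (h' : IsIsom Φ L' L'') :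
    IsIsom Φ L L'' := by
  obtain ⟨g, hg, h⟩ := h
  obtain ⟨g', hg', h'⟩ := h'
  refine ⟨g.trans g', fun x y => by simp [hg, hg'], fun i => ?_⟩
  rw [← h' i, ← h i, Set.image_image]; rfl

theorem isIsom_equivalence (Φ : LinearMap.BilinForm K V) {ι : Type*}
    (S : Set (ι → Submodule (𝓞 K) V)) :
    Equivalence (fun X Y : S => IsIsom Φ X.1 Y.1) :=
  ⟨fun _ => ⟨LinearEquiv.refl K V, fun _ _ => rfl, fun _ => Set.image_id _⟩,
    fun h => h.symm', fun h h' => h.trans' h'⟩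

theorem exists_nat_smul_mem {m : ℕ} (L : Fin m → Submodule (𝓞 K) V)
    (hlat : ∀ i, IsZLat (L i)) :
    ∃ a : ℕ, a ≠ 0 ∧ ∀ i j, ∀ x ∈ L i, a • x ∈ L j := by
  choose d hd h using fun i j => exists_smul_mem_of_fg (L i) (L j) (hlat i).1 (hlat j).2
  let D : 𝓞 K := ∏ i, ∏ j, d i j
  have hD : D ≠ 0 := Finset.prod_ne_zero_iff.2 fun i _ =>
    Finset.prod_ne_zero_iff.2 fun j _ => hd i j
  refine ⟨Ideal.absNorm (Ideal.span {D}), ?_, fun i j x hx => ?_⟩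
  · rw [Ne, Ideal.absNorm_eq_zero_iff, Ideal.span_singleton_eq_bot]; exact hD
  · have h1 := Ideal.absNorm_mem (Ideal.span {D})
    rw [Ideal.mem_span_singleton] at h1
    have h2 : d i j ∣ D := (Finset.dvd_prod_of_mem (fun j => d i j) (Finset.mem_univ j)).trans
      (Finset.dvd_prod_of_mem (fun i => ∏ j, d i j) (Finset.mem_univ i))
    obtain ⟨c, hc⟩ := h2.trans h1
    rw [← Nat.cast_smul_eq_nsmul (𝓞 K), hc, mul_comm, mul_smul]
    exact (L j).smul_mem _ (h i j x hx)

theorem genus_tuple_finitely_many_classes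
    [FiniteDimensional K V]
    (Φ : LinearMap.BilinForm K V)
    (hsymm : ∀ x y : V, Φ x y = Φ y x)
    (hnd : ∀ x : V, (∀ y : V, Φ x y = 0) → x = 0)
    (m : ℕ) (hm : 0 < m) (L : Fin m → Submodule (𝓞 K) V)
    (hlat : ∀ i, IsZLat (L i))
    (hfin : Finite (Quot (fun X Y : genusSet Φ (fun _ : Fin 1 => L ⟨0, hm⟩) =>
      IsIsom Φ X.1 Y.1))) :
    Finite (Quot (fun X Y : genusSet Φ L => IsIsom Φ X.1 Y.1)) := by
  obtain ⟨a, ha, haL⟩ := exists_nat_smul_mem L hlat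
  let i0 : Fin m := ⟨0, hm⟩
  let G := genusSet Φ (fun _ : Fin 1 => L ⟨0, hm⟩)
  let r : G → G → Prop := fun X Y => IsIsom Φ X.1 Y.1
  have hmem : ∀ X : genusSet Φ L, (fun _ : Fin 1 => X.1 i0) ∈ G := by
    intro X
    refine ⟨fun _ => X.2.1 i0, fun v => ?_⟩
    obtain ⟨g, hg, h⟩ := X.2.2 v
    exact ⟨g, hg, fun _ => h i0⟩
  let q : genusSet Φ L → Quot r := fun X => Quot.mk r ⟨_, hmem X⟩
  let R : Quot r → Submodule (𝓞 K) V := fun c => c.out.1 0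
  have hR : ∀ c, IsZLat (R c) := fun c => c.out.2.1 0
  let S : Quot r → Set (Submodule (𝓞 K) V) := fun c =>
    {M | (∀ x ∈ R c, a • x ∈ M) ∧ ∀ x ∈ M, a • x ∈ R c}
  have hS : ∀ c, Finite (S c) := fun c => finite_between (R c) (hR c).1 a ha
  have hex : ∀ X : genusSet Φ L, ∃ Y : Fin m → S (q X), IsIsom Φ X.1 (fun i => (Y i).1) := by
    intro X
    have h1 : Quot.mk r ⟨_, hmem X⟩ = Quot.mk r (q X).out := (Quot.out_eq (q X)).symm
    have h2 : r ⟨_, hmem X⟩ (q X).out :=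
      ((isIsom_equivalence Φ G).quot_mk_eq_iff _ _).1 h1
    obtain ⟨g, hg, hgX⟩ := h2
    have hg0 : ∀ x, x ∈ R (q X) ↔ ∃ y ∈ X.1 i0, g y = x := by
      intro x
      have := hgX 0
      rw [← SetLike.mem_coe, ← this]; rfl
    let g' : V →ₗ[𝓞 K] V := g.toLinearMap.restrictScalars (𝓞 K)
    have ht := transfer_smul_mem Φ L X.1 X.2
    refine ⟨fun i => ⟨(X.1 i).map g', ?_, ?_⟩, g, hg, fun i => rfl⟩
    · intro x hx
      obtain ⟨y, hy, rfl⟩ := (hg0 x).1 hx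
      exact ⟨a • y, ht i0 i a (haL i0 i) y hy, map_nsmul g a y⟩
    · rintro _ ⟨y, hy, rfl⟩
      exact (hg0 _).2 ⟨a • y, ht i i0 a (haL i i0) y hy, map_nsmul g a y⟩
  choose Y hY using hex
  have hfin' : Finite (Quot r) := hfin
  let F : genusSet Φ L → Σ c : Quot r, (Fin m → S c) := fun X => ⟨q X, Y X⟩
  let p : (Σ c : Quot r, (Fin m → S c)) → (Fin m → Submodule (𝓞 K) V) :=
    fun z i => (z.2 i).1
  have hF : ∀ X X', F X = F X' → IsIsom Φ X.1 X'.1 := by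
    intro X X' h
    have h1 : IsIsom Φ X.1 (p (F X)) := hY X
    have h2 : IsIsom Φ X'.1 (p (F X')) := hY X'
    rw [← h] at h2
    exact h1.trans' h2.symm'
  refine Finite.of_injective (fun c => F c.out) fun c c' h => ?_
  rw [← Quot.out_eq c, ← Quot.out_eq c']
  exact Quot.sound (hF _ _ h)
end

section
/- Let L and L' be Z_K-lattices in V lying in the same genus and let p be a maximal ideal of Z_K. Then ρ_p(L) and ρ_p(L') lie in the same genus. Likewise, if L and L' are isometric, then ρ_p(L) and ρ_p(L') are isometric. -/
/-
STATEMENT 10: Let L and L' be Z_K-lattices in V lying in the same genus and let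
p be a maximal ideal of Z_K.  Then ρ_p(L) and ρ_p(L') lie in the same genus.
Likewise, if L and L' are isometric, then ρ_p(L) and ρ_p(L') are isometric.
-/

set_option maxHeartbeats 1000000
set_option synthInstance.maxHeartbeats 1000000

open NumberField IsDedekindDomain TensorProduct
open scoped nonZeroDivisors

variable {K : Type*} [Field K] [NumberField K]
variable {V : Type*} [AddCommGroup V] [Module K V]
  [Module (𝓞 K) V] [IsScalarTower (𝓞 K) K V]

/-- The dual lattice `L^# = {x ∈ V : Φ(x, L) ⊆ Z_K}`. -/
def dualLatK (Φ : LinearMap.BilinForm K V) (L : Submodule (𝓞 K) V) :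
    Submodule (𝓞 K) V where
  carrier := {x | ∀ y ∈ L, Φ x y ∈ (algebraMap (𝓞 K) K).range}
  add_mem' := by
    intro x x' hx hx' y hy
    rw [map_add, LinearMap.add_apply]
    exact add_mem (hx y hy) (hx' y hy)
  zero_mem' := by
    intro y hy
    rw [map_zero, LinearMap.zero_apply]
    exact zero_mem _
  smul_mem' := by
    intro c x hx y hy
    have h1 : (c • x : V) = (algebraMap (𝓞 K) K c) • x := (algebraMap_smul K c x).symm
    rw [h1, map_smul, LinearMap.smul_apply, smul_eq_mul]
    exact mul_mem ⟨c, rfl⟩ (hx y hy)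

/-- The product `I·N` of a fractional ideal `I` of `K` (given as a
`Z_K`-submodule of `K`) with a lattice `N`, taken inside `V`. -/
def smulLatK (I : Submodule (𝓞 K) K) (N : Submodule (𝓞 K) V) : Submodule (𝓞 K) V :=
  Submodule.span (𝓞 K) (Set.image2 (fun (a : K) (v : V) => a • v) (I : Set K) (N : Set V))

/-- The operator `ρ_p(L) = L + (p⁻¹L ∩ p·L^#)`. -/
noncomputable def rhoK (Φ : LinearMap.BilinForm K V) (p : Ideal (𝓞 K))
    (L : Submodule (𝓞 K) V) : Submodule (𝓞 K) V :=
  L ⊔ (smulLatK ((((p : FractionalIdeal (𝓞 K)⁰ K))⁻¹ : FractionalIdeal (𝓞 K)⁰ K) :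
        Submodule (𝓞 K) K) L ⊓
      smulLatK (((p : FractionalIdeal (𝓞 K)⁰ K)) : Submodule (𝓞 K) K) (dualLatK Φ L))


section helpers

set_option linter.unusedSectionVars false

lemma rk_int {v : HeightOneSpectrum (𝓞 K)} {c : K}
    (hc : algebraMap K (v.adicCompletion K) c ∈ v.adicCompletionIntegers K) :
    ∃ s : 𝓞 K, s ∉ v.asIdeal ∧ ∃ r : 𝓞 K, algebraMap (𝓞 K) K s * c = algebraMap (𝓞 K) K r := by
  have h1 : v.valuation K c ≤ 1 := by
    rw [HeightOneSpectrum.mem_adicCompletionIntegers] at hc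
    rw [← HeightOneSpectrum.valuedAdicCompletion_eq_valuation']
    exact hc
  obtain ⟨n, d, h⟩ := HeightOneSpectrum.exists_primeCompl_mul_eq_of_integer v c h1
  exact ⟨d, d.2, n, by rw [mul_comm]; exact h⟩

lemma rk_val (v : HeightOneSpectrum (𝓞 K)) (c : K) :
    Valued.v (algebraMap K (v.adicCompletion K) c) = v.valuation K c :=
  HeightOneSpectrum.valuedAdicCompletion_eq_valuation' v c

lemma rk_coe_int (v : HeightOneSpectrum (𝓞 K)) (r : 𝓞 K) :
    algebraMap K (v.adicCompletion K) (algebraMap (𝓞 K) K r) ∈ v.adicCompletionIntegers K := by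
  rw [HeightOneSpectrum.mem_adicCompletionIntegers, rk_val]
  exact v.valuation_le_one r

lemma rk_inv_int (v : HeightOneSpectrum (𝓞 K)) (r : 𝓞 K) (hr : r ∉ v.asIdeal) :
    (algebraMap K (v.adicCompletion K) (algebraMap (𝓞 K) K r))⁻¹ ∈
      v.adicCompletionIntegers K := by
  rw [HeightOneSpectrum.mem_adicCompletionIntegers, map_inv₀, rk_val,
    (HeightOneSpectrum.valuation_eq_one_iff_notMem v).2 hr, inv_one]

lemma rk_div {v : HeightOneSpectrum (𝓞 K)} {x d : v.adicCompletion K} (hd : d ≠ 0)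
    (h : Valued.v x ≤ Valued.v d) : ∃ a ∈ v.adicCompletionIntegers K, x = d * a := by
  refine ⟨x / d, ?_, by field_simp⟩
  rw [HeightOneSpectrum.mem_adicCompletionIntegers, map_div₀]
  exact div_le_one_of_le₀ h zero_le

lemma rk_approx (v : HeightOneSpectrum (𝓞 K)) (x d : v.adicCompletion K) (hd : d ≠ 0) :
    ∃ c : K, ∃ a ∈ v.adicCompletionIntegers K,
      x = algebraMap K (v.adicCompletion K) c + d * a := by
  have hopen : IsOpen {y : v.adicCompletion K | Valued.v (x - y) < Valued.v d} := by
    have h0 : IsOpen {y : v.adicCompletion K | Valued.v y < Valued.v d} := by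
      have h := Valued.isOpen_ball (v.adicCompletion K)
        ((Valued.v (R := v.adicCompletion K)).restrict d)
      simpa only [Valuation.restrict_lt_iff] using h
    exact h0.preimage (continuous_const.sub continuous_id)
  obtain ⟨c, hc⟩ := (HeightOneSpectrum.denseRange_algebraMap K v).exists_mem_open hopen
    ⟨x, by simpa using zero_lt_iff.2 (by simpa using hd)⟩
  obtain ⟨a, ha, h⟩ := rk_div hd (le_of_lt hc)
  exact ⟨c, a, ha, by rw [← h]; ring⟩

lemma rk_smul_def (r : 𝓞 K) (x : V) : r • x = (algebraMap (𝓞 K) K r) • x :=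
  (algebraMap_smul K r x).symm

lemma rk_tmul_smul (v : HeightOneSpectrum (𝓞 K)) (c : K) (x : V) :
    (1 : v.adicCompletion K) ⊗ₜ[K] (c • x) =
      algebraMap K (v.adicCompletion K) c • ((1 : v.adicCompletion K) ⊗ₜ[K] x) := by
  rw [TensorProduct.tmul_smul, algebraMap_smul]

lemma rk_lat_smul {v : HeightOneSpectrum (𝓞 K)} {N : Submodule (𝓞 K) V}
    {a : v.adicCompletion K} (ha : a ∈ v.adicCompletionIntegers K)
    {x : (v.adicCompletion K) ⊗[K] V} (hx : x ∈ latCompletion v N) :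
    a • x ∈ latCompletion v N :=
  (latCompletion v N).smul_mem (⟨a, ha⟩ : (v.adicCompletionIntegers K).toSubring) hx

lemma rk_lat_of {v : HeightOneSpectrum (𝓞 K)} {N : Submodule (𝓞 K) V} {x : V} (hx : x ∈ N) :
    (1 : v.adicCompletion K) ⊗ₜ[K] x ∈ latCompletion v N :=
  Submodule.subset_span ⟨x, hx, rfl⟩

lemma rk_lat_ind {v : HeightOneSpectrum (𝓞 K)} {N : Submodule (𝓞 K) V}
    {P : (v.adicCompletion K) ⊗[K] V → Prop}
    (h1 : ∀ x ∈ N, P ((1 : v.adicCompletion K) ⊗ₜ[K] x))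
    (h0 : P 0) (hadd : ∀ x y, P x → P y → P (x + y))
    (hs : ∀ a ∈ v.adicCompletionIntegers K, ∀ x, P x → P (a • x))
    {x} (hx : x ∈ latCompletion v N) : P x := by
  induction hx using Submodule.span_induction with
  | mem x h => obtain ⟨y, hy, rfl⟩ := h; exact h1 y hy
  | zero => exact h0
  | add x y _ _ hx hy => exact hadd _ _ hx hy
  | smul a x _ hx => exact hs a.1 a.2 x hx

/-- if `s x ∈ N` locally with `s` a local unit then `x` is in the completion. -/
lemma rk_lat_of_smul {v : HeightOneSpectrum (𝓞 K)} {N : Submodule (𝓞 K) V} {x : V}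
    {s : 𝓞 K} (hs : s ∉ v.asIdeal) (hx : s • x ∈ N) :
    (1 : v.adicCompletion K) ⊗ₜ[K] x ∈ latCompletion v N := by
  have h := rk_lat_smul (rk_inv_int v s hs) (rk_lat_of (v := v) hx)
  have hs0 : algebraMap K (v.adicCompletion K) (algebraMap (𝓞 K) K s) ≠ 0 := by
    simp only [ne_eq, map_eq_zero]
    intro h0
    apply hs
    rw [(map_eq_zero_iff _ (FaithfulSMul.algebraMap_injective (𝓞 K) K)).1 h0]
    exact zero_mem _
  rwa [rk_smul_def, rk_tmul_smul, smul_smul, inv_mul_cancel₀ hs0, one_smul] at h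

lemma rk_denom {ι : Type*} [Finite ι] {L : Submodule (𝓞 K) V} (hL : L.FG)
    (f : ι → V →ₗ[K] K) : ∃ d : 𝓞 K, d ≠ 0 ∧ ∀ l ∈ L, ∀ i,
      algebraMap (𝓞 K) K d * f i l ∈ (algebraMap (𝓞 K) K).range := by
  obtain ⟨S, rfl⟩ := hL
  cases nonempty_fintype ι
  obtain ⟨b, hb⟩ := IsLocalization.exist_integer_multiples (R := 𝓞 K) (S := K) (𝓞 K)⁰
    (S ×ˢ (Finset.univ : Finset ι)) (fun q => f q.2 q.1)
  refine ⟨b, nonZeroDivisors.coe_ne_zero b, fun l hl i => ?_⟩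
  induction hl using Submodule.span_induction with
  | mem x h =>
    obtain ⟨r, hr⟩ := hb (x, i) (by simpa using h)
    exact ⟨r, by rw [hr, Algebra.smul_def]⟩
  | zero => simp
  | add x y _ _ hx hy => rw [map_add, mul_add]; exact add_mem hx hy
  | smul a x _ hx =>
    rw [rk_smul_def, map_smul, smul_eq_mul, mul_left_comm]
    exact mul_mem ⟨a, rfl⟩ hx

lemma rk_unit_denom {v : HeightOneSpectrum (𝓞 K)} {L : Submodule (𝓞 K) V} (hL : L.FG)
    (f : V →ₗ[K] K)
    (hf : ∀ l ∈ L, algebraMap K (v.adicCompletion K) (f l) ∈ v.adicCompletionIntegers K) :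
    ∃ s : 𝓞 K, s ∉ v.asIdeal ∧ ∀ l ∈ L,
      algebraMap (𝓞 K) K s * f l ∈ (algebraMap (𝓞 K) K).range := by
  classical
  obtain ⟨S, rfl⟩ := hL
  have key : ∀ T : Finset V, (∀ x ∈ T, x ∈ S) → ∃ s : 𝓞 K, s ∉ v.asIdeal ∧ ∀ l ∈ T,
      algebraMap (𝓞 K) K s * f l ∈ (algebraMap (𝓞 K) K).range := by
    intro T
    induction T using Finset.induction_on with
    | empty => exact fun _ => ⟨1, (Ideal.ne_top_iff_one _).1 v.isPrime.ne_top, by simp⟩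
    | insert x T hx ih =>
      intro h
      obtain ⟨s, hs, h1⟩ := ih fun y hy => h y (Finset.mem_insert_of_mem hy)
      obtain ⟨t, ht, r, hr⟩ := rk_int (hf x (Submodule.subset_span (h x (by simp))))
      refine ⟨s * t, fun h => (v.isPrime.mem_or_mem h).elim hs ht, fun l hl => ?_⟩
      rcases Finset.mem_insert.1 hl with rfl | hl
      · rw [map_mul, mul_assoc, hr]; exact mul_mem ⟨_, rfl⟩ ⟨_, rfl⟩
      · rw [map_mul, mul_right_comm]; exact mul_mem (h1 l hl) ⟨_, rfl⟩
  obtain ⟨s, hs, h⟩ := key S fun _ h => h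
  refine ⟨s, hs, fun l hl => ?_⟩
  induction hl using Submodule.span_induction with
  | mem x hx => exact h x hx
  | zero => simp
  | add x y _ _ hx hy => rw [map_add, mul_add]; exact add_mem hx hy
  | smul a x _ hx =>
    rw [rk_smul_def, map_smul, smul_eq_mul, mul_left_comm]
    exact mul_mem ⟨a, rfl⟩ hx

/-- The localization of `L` at `v`, inside `V`. -/
def rkLoc (v : HeightOneSpectrum (𝓞 K)) (L : Submodule (𝓞 K) V) : Submodule (𝓞 K) V where
  carrier := {x | ∃ s : 𝓞 K, s ∉ v.asIdeal ∧ s • x ∈ L}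
  add_mem' := by
    rintro x y ⟨s, hs, hx⟩ ⟨t, ht, hy⟩
    refine ⟨s * t, fun h => (v.isPrime.mem_or_mem h).elim hs ht, ?_⟩
    rw [smul_add]
    refine add_mem ?_ ?_
    · rw [mul_comm, mul_smul]; exact L.smul_mem _ hx
    · rw [mul_smul]; exact L.smul_mem _ hy
  zero_mem' := ⟨1, (Ideal.ne_top_iff_one _).1 v.isPrime.ne_top, by simp⟩
  smul_mem' := by
    rintro c x ⟨s, hs, hx⟩
    exact ⟨s, hs, by rw [smul_comm]; exact L.smul_mem _ hx⟩

lemma rkLoc_smul {v : HeightOneSpectrum (𝓞 K)} {L : Submodule (𝓞 K) V} {c : K}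
    (hc : algebraMap K (v.adicCompletion K) c ∈ v.adicCompletionIntegers K) {x : V}
    (hx : x ∈ rkLoc v L) : c • x ∈ rkLoc v L := by
  obtain ⟨s, hs, h⟩ := hx
  obtain ⟨t, ht, r, hr⟩ := rk_int hc
  refine ⟨s * t, fun h => (v.isPrime.mem_or_mem h).elim hs ht, ?_⟩
  have : (s * t) • c • x = r • s • x := by
    simp only [rk_smul_def, smul_smul, map_mul, ← hr]
    congr 1; ring
  rw [this]
  exact L.smul_mem _ h

lemma rk_basis [FiniteDimensional K V] {L : Submodule (𝓞 K) V} (hL : IsZLat L) :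
    ∃ (n : ℕ) (e : Module.Basis (Fin n) K V), ∀ i, e i ∈ L := by
  let b := Module.Basis.ofSpan hL.2.ge
  have := Module.Finite.finite_basis b
  refine ⟨_, b.reindex (Finite.equivFin _), fun i => ?_⟩
  rw [Module.Basis.reindex_apply]
  exact Module.Basis.ofSpan_subset hL.2.ge ⟨_, rfl⟩

lemma rk_loc_of_lat [FiniteDimensional K V] {v : HeightOneSpectrum (𝓞 K)}
    {L : Submodule (𝓞 K) V} (hL : IsZLat L) {y : V}
    (hy : (1 : v.adicCompletion K) ⊗ₜ[K] y ∈ latCompletion v L) : y ∈ rkLoc v L := by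
  obtain ⟨n, e, he⟩ := rk_basis hL
  obtain ⟨d, hd0, hd⟩ := rk_denom hL.1 (fun i => e.coord i)
  set D : v.adicCompletion K := algebraMap K (v.adicCompletion K) (algebraMap (𝓞 K) K d) with hD
  have hDint : D ∈ v.adicCompletionIntegers K := rk_coe_int v d
  have hD0 : D ≠ 0 := by
    simp only [hD, ne_eq, map_eq_zero]
    rwa [map_eq_zero_iff _ (FaithfulSMul.algebraMap_injective (𝓞 K) K)]
  have step1 : ∀ x ∈ latCompletion v L, ∃ w ∈ rkLoc v L, ∃ z ∈ latCompletion v L,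
      x = (1 : v.adicCompletion K) ⊗ₜ[K] w + D • z := by
    intro x hx
    refine rk_lat_ind (P := fun x => ∃ w ∈ rkLoc v L, ∃ z ∈ latCompletion v L,
      x = (1 : v.adicCompletion K) ⊗ₜ[K] w + D • z) ?_ ?_ ?_ ?_ hx
    · intro x hx
      exact ⟨x, ⟨1, (Ideal.ne_top_iff_one _).1 v.isPrime.ne_top, by simpa using hx⟩, 0,
        zero_mem _, by simp⟩
    · exact ⟨0, zero_mem _, 0, zero_mem _, by simp⟩
    · rintro _ _ ⟨w, hw, z, hz, rfl⟩ ⟨w', hw', z', hz', rfl⟩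
      refine ⟨w + w', add_mem hw hw', z + z', add_mem hz hz', ?_⟩
      rw [TensorProduct.tmul_add, smul_add]; abel
    · rintro a ha _ ⟨w, hw, z, hz, rfl⟩
      obtain ⟨c, a', ha', h⟩ := rk_approx v a D hD0
      have hc : algebraMap K (v.adicCompletion K) c ∈ v.adicCompletionIntegers K := by
        have : algebraMap K (v.adicCompletion K) c = a - D * a' := by rw [h]; ring
        rw [this]
        exact sub_mem ha (mul_mem hDint ha')
      refine ⟨c • w, rkLoc_smul hc hw, a' • ((1 : v.adicCompletion K) ⊗ₜ[K] w) + a • z,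
        add_mem (rk_lat_smul ha' ?_) (rk_lat_smul ha hz), ?_⟩
      · obtain ⟨s, hs, hsw⟩ := hw
        exact rk_lat_of_smul hs hsw
      · rw [rk_tmul_smul, smul_add, smul_add, smul_smul, smul_smul, smul_smul, ← add_assoc,
          ← add_smul, ← h, mul_comm a D]
  let B := Algebra.TensorProduct.basis (v.adicCompletion K) e
  have hB : ∀ (w : V) i, B.repr ((1 : v.adicCompletion K) ⊗ₜ[K] w) i =
      algebraMap K (v.adicCompletion K) (e.repr w i) := by
    intro w i
    simp [B]
  have step2 : ∀ z ∈ latCompletion v L, ∀ i,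
      B.repr (D • z) i ∈ v.adicCompletionIntegers K := by
    intro z hz i
    refine rk_lat_ind (P := fun z => B.repr (D • z) i ∈ v.adicCompletionIntegers K)
      ?_ ?_ ?_ ?_ hz
    · intro x hx
      obtain ⟨r, hr⟩ := hd x hx i
      rw [map_smul, Finsupp.smul_apply, hB, smul_eq_mul, hD, ← map_mul]
      rw [Module.Basis.coord_apply] at hr
      rw [← hr]
      exact rk_coe_int v r
    · rw [smul_zero, map_zero]; exact zero_mem _
    · intro x y hx hy
      rw [smul_add, map_add]
      exact add_mem hx hy
    · intro a ha x hx
      rw [smul_comm, map_smul]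
      exact mul_mem ha hx
  obtain ⟨w, hw, z, hz, h⟩ := step1 _ hy
  have h3 : y - w ∈ rkLoc v L := by
    rw [← e.sum_repr (y - w)]
    refine sum_mem fun i _ => rkLoc_smul ?_ ?_
    · rw [← hB, TensorProduct.tmul_sub, h, add_sub_cancel_left]
      exact step2 z hz i
    · exact ⟨1, (Ideal.ne_top_iff_one _).1 v.isPrime.ne_top, by simpa using he i⟩
  simpa using add_mem h3 hw

/-- The local description of the completion of `ρ_p(L)` at `p`. -/
def rkSet (v : HeightOneSpectrum (𝓞 K)) (Φ : LinearMap.BilinForm K V) (π : 𝓞 K)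
    (M : Set ((v.adicCompletion K) ⊗[K] V)) : Set ((v.adicCompletion K) ⊗[K] V) :=
  {x | ∃ m ∈ M, ∃ z, x = m + z ∧
    algebraMap K (v.adicCompletion K) (algebraMap (𝓞 K) K π) • z ∈ M ∧
    ∀ l ∈ M, ∃ a ∈ v.adicCompletionIntegers K, Φ.baseChange (v.adicCompletion K) z l =
      algebraMap K (v.adicCompletion K) (algebraMap (𝓞 K) K π) * a}

lemma rkSet_image {v : HeightOneSpectrum (𝓞 K)} {Φ : LinearMap.BilinForm K V} {π : 𝓞 K}
    {M M' : Set ((v.adicCompletion K) ⊗[K] V)}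
    (g : ((v.adicCompletion K) ⊗[K] V) ≃ₗ[v.adicCompletion K] ((v.adicCompletion K) ⊗[K] V))
    (hg : ∀ x y, Φ.baseChange (v.adicCompletion K) (g x) (g y) =
        Φ.baseChange (v.adicCompletion K) x y) (hM : ⇑g '' M = M') :
    ⇑g '' rkSet v Φ π M = rkSet v Φ π M' := by
  subst hM
  ext x
  constructor
  · rintro ⟨_, ⟨m, hm, z, rfl, h1, h2⟩, rfl⟩
    refine ⟨g m, ⟨m, hm, rfl⟩, g z, map_add _ _ _, ?_, ?_⟩
    · rw [← map_smul]; exact ⟨_, h1, rfl⟩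
    · rintro _ ⟨l, hl, rfl⟩
      rw [hg]; exact h2 l hl
  · rintro ⟨_, ⟨m, hm, rfl⟩, z, rfl, h1, h2⟩
    obtain ⟨z, rfl⟩ := g.surjective z
    refine ⟨m + z, ⟨m, hm, z, rfl, ?_, ?_⟩, map_add _ _ _⟩
    · obtain ⟨w, hw, h⟩ := h1
      rw [← map_smul] at h
      rwa [← g.injective h]
    · intro l hl
      rw [← hg]; exact h2 _ ⟨l, hl, rfl⟩

lemma rk_inv_smul {p : Ideal (𝓞 K)} (hp0 : p ≠ ⊥) {L : Submodule (𝓞 K) V} {x : V}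
    (hx : x ∈ smulLatK ((((p : FractionalIdeal (𝓞 K)⁰ K))⁻¹ : FractionalIdeal (𝓞 K)⁰ K) :
        Submodule (𝓞 K) K) L) {t : 𝓞 K} (ht : t ∈ p) : t • x ∈ L := by
  induction hx using Submodule.span_induction with
  | mem x h =>
    obtain ⟨a, ha, l, hl, rfl⟩ := h
    have ha' : a ∈ (p : FractionalIdeal (𝓞 K)⁰ K)⁻¹ := ha
    rw [FractionalIdeal.mem_inv_iff (FractionalIdeal.coeIdeal_ne_zero.2 hp0)] at ha'
    obtain ⟨r, hr⟩ := (FractionalIdeal.mem_one_iff _).1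
      (ha' (algebraMap (𝓞 K) K t) (FractionalIdeal.mem_coeIdeal_of_mem _ ht))
    have : t • a • l = r • l := by
      rw [rk_smul_def, rk_smul_def, smul_smul, mul_comm, hr]
    show t • a • l ∈ L
    rw [this]
    exact L.smul_mem _ hl
  | zero => simp
  | add x y _ _ hx hy => rw [smul_add]; exact add_mem hx hy
  | smul a x _ hx => rw [smul_comm]; exact L.smul_mem _ hx

lemma rk_unif (v : HeightOneSpectrum (𝓞 K)) : ∃ π : 𝓞 K, π ≠ 0 ∧ π ∈ v.asIdeal ∧
    (∀ a ∈ v.asIdeal, v.intValuation a ≤ v.intValuation π) ∧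
    ∃ t : 𝓞 K, t ∉ v.asIdeal ∧ ∀ a ∈ v.asIdeal, ∃ b, t * a = π * b := by
  obtain ⟨π, hπ⟩ := v.intValuation_exists_uniformizer
  have hmem : π ∈ v.asIdeal := by
    have := (v.intValuation_le_pow_iff_mem π 1).1 (by simpa using hπ.le)
    simpa using this
  refine ⟨π, ?_, hmem, ?_, ?_⟩
  · rintro rfl
    rw [map_zero] at hπ
    exact WithZero.exp_ne_zero hπ.symm
  · intro a ha
    rw [hπ]
    have := (v.intValuation_le_pow_iff_mem a 1).2 (by simpa using ha)
    simpa using this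
  · have hdvd : v.asIdeal ∣ Ideal.span {π} := by
      rw [Ideal.dvd_iff_le, Ideal.span_singleton_le_iff_mem]; exact hmem
    obtain ⟨I, hI⟩ := hdvd
    have hnot : ¬ I ≤ v.asIdeal := by
      intro hle
      have h2 : π ∈ v.asIdeal ^ 2 := by
        have : π ∈ Ideal.span {π} := Ideal.mem_span_singleton_self π
        rw [hI] at this
        rw [pow_two]
        exact Ideal.mul_mono_right hle this
      have := (v.intValuation_le_pow_iff_mem π 2).2 h2
      rw [hπ, WithZero.exp_le_exp] at this
      norm_num at this
    obtain ⟨t, htI, ht⟩ := Set.not_subset.1 hnot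
    refine ⟨t, ht, fun a ha => ?_⟩
    have : t * a ∈ Ideal.span {π} := by
      rw [hI, mul_comm t a]; exact Ideal.mul_mem_mul ha htI
    exact Ideal.mem_span_singleton'.1 this |>.imp fun b hb => by rw [← hb, mul_comm]

lemma rk_bc (v : HeightOneSpectrum (𝓞 K)) (Φ : LinearMap.BilinForm K V) (x y : V) :
    Φ.baseChange (v.adicCompletion K) ((1 : v.adicCompletion K) ⊗ₜ[K] x)
      ((1 : v.adicCompletion K) ⊗ₜ[K] y) = algebraMap K (v.adicCompletion K) (Φ x y) := by
  rw [LinearMap.BilinForm.baseChange_tmul, mul_one, Algebra.algebraMap_eq_smul_one]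

lemma rk_rho_of_ne {v : HeightOneSpectrum (𝓞 K)} (Φ : LinearMap.BilinForm K V)
    {p : Ideal (𝓞 K)} (hp0 : p ≠ ⊥) (hp : p.IsMaximal) (hv : v.asIdeal ≠ p)
    (L : Submodule (𝓞 K) V) : latCompletion v (rhoK Φ p L) = latCompletion v L := by
  have hnot : ¬ p ≤ v.asIdeal := fun h => hv (hp.eq_of_le v.isPrime.ne_top h).symm
  obtain ⟨t, htp, ht⟩ := Set.not_subset.1 hnot
  apply le_antisymm
  · refine Submodule.span_le.2 ?_
    rintro _ ⟨x, hx, rfl⟩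
    obtain ⟨l, hl, z, hz, rfl⟩ := Submodule.mem_sup.1 hx
    show (1 : v.adicCompletion K) ⊗ₜ[K] (l + z) ∈ latCompletion v L
    rw [TensorProduct.tmul_add]
    exact add_mem (rk_lat_of hl) (rk_lat_of_smul ht (rk_inv_smul hp0 hz.1 htp))
  · exact Submodule.span_mono (Set.image_mono (SetLike.coe_subset_coe.2 le_sup_left))

lemma rk_bc_ind {v : HeightOneSpectrum (𝓞 K)} (Φ : LinearMap.BilinForm K V)
    {L : Submodule (𝓞 K) V} {ϖ : v.adicCompletion K} {z : (v.adicCompletion K) ⊗[K] V}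
    (h : ∀ l ∈ L, ∃ a ∈ v.adicCompletionIntegers K,
      Φ.baseChange (v.adicCompletion K) z ((1 : v.adicCompletion K) ⊗ₜ[K] l) = ϖ * a) :
    ∀ l ∈ latCompletion v L, ∃ a ∈ v.adicCompletionIntegers K,
      Φ.baseChange (v.adicCompletion K) z l = ϖ * a := by
  intro l hl
  refine rk_lat_ind (P := fun l => ∃ a ∈ v.adicCompletionIntegers K,
      Φ.baseChange (v.adicCompletion K) z l = ϖ * a) h ?_ ?_ ?_ hl
  · exact ⟨0, zero_mem _, by rw [map_zero, mul_zero]⟩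
  · rintro x y ⟨a, ha, hx⟩ ⟨b, hb, hy⟩
    exact ⟨a + b, add_mem ha hb, by rw [map_add, hx, hy, mul_add]⟩
  · rintro c hc x ⟨a, ha, hx⟩
    exact ⟨c * a, mul_mem hc ha, by rw [map_smul, hx, smul_eq_mul, mul_left_comm]⟩

lemma rk_rho_le {v : HeightOneSpectrum (𝓞 K)} (Φ : LinearMap.BilinForm K V)
    (L : Submodule (𝓞 K) V) {π : 𝓞 K} (hπ0 : π ≠ 0) (hπ : π ∈ v.asIdeal)
    (hmax : ∀ a ∈ v.asIdeal, v.intValuation a ≤ v.intValuation π) :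
    (latCompletion v (rhoK Φ v.asIdeal L) : Set _) ⊆
      rkSet v Φ π (latCompletion v L : Set _) := by
  have hϖ0 : algebraMap K (v.adicCompletion K) (algebraMap (𝓞 K) K π) ≠ 0 := by
    simp only [ne_eq, map_eq_zero]
    rwa [map_eq_zero_iff _ (FaithfulSMul.algebraMap_injective (𝓞 K) K)]
  intro x hx
  refine rk_lat_ind (P := fun x => x ∈ rkSet v Φ π (latCompletion v L : Set _))
    ?_ ?_ ?_ ?_ hx
  · intro x hx
    obtain ⟨l, hl, z, ⟨hz1, hz2⟩, rfl⟩ := Submodule.mem_sup.1 hx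
    refine ⟨(1 : v.adicCompletion K) ⊗ₜ[K] l, rk_lat_of hl, (1 : v.adicCompletion K) ⊗ₜ[K] z,
      TensorProduct.tmul_add _ _ _, ?_, ?_⟩
    · rw [← rk_tmul_smul, ← rk_smul_def]
      exact rk_lat_of (rk_inv_smul v.ne_bot hz1 hπ)
    · refine rk_bc_ind Φ fun l hl => ?_
      rw [rk_bc]
      have hz2' : z ∈ smulLatK (((v.asIdeal : FractionalIdeal (𝓞 K)⁰ K)) :
        Submodule (𝓞 K) K) (dualLatK Φ L) := hz2
      clear hz1 hz2 hx
      induction hz2' using Submodule.span_induction with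
      | mem x h =>
        obtain ⟨a, ha, w, hw, rfl⟩ := h
        obtain ⟨a, ha', rfl⟩ := (FractionalIdeal.mem_coeIdeal _).1 ha
        obtain ⟨r, hr⟩ := hw l hl
        obtain ⟨b, hb, hab⟩ := rk_div
          (x := algebraMap K (v.adicCompletion K) (algebraMap (𝓞 K) K a)) hϖ0 (by
            rw [rk_val, rk_val, HeightOneSpectrum.valuation_of_algebraMap,
              HeightOneSpectrum.valuation_of_algebraMap]
            exact hmax a ha')
        refine ⟨b * algebraMap K (v.adicCompletion K) (algebraMap (𝓞 K) K r),
          mul_mem hb (rk_coe_int v r), ?_⟩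
        show algebraMap K (v.adicCompletion K) (Φ (algebraMap (𝓞 K) K a • w) l) = _
        rw [map_smul, LinearMap.smul_apply, smul_eq_mul, map_mul, ← hr, hab, mul_assoc]
      | zero => exact ⟨0, zero_mem _, by simp⟩
      | add x y _ _ hx hy =>
        obtain ⟨a, ha, hx⟩ := hx
        obtain ⟨b, hb, hy⟩ := hy
        exact ⟨a + b, add_mem ha hb, by
          rw [map_add, LinearMap.add_apply, map_add, hx, hy, mul_add]⟩
      | smul c x _ hx =>
        obtain ⟨a, ha, hx⟩ := hx
        exact ⟨_, mul_mem (rk_coe_int v c) ha, by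
          rw [rk_smul_def, map_smul, LinearMap.smul_apply, smul_eq_mul, map_mul, hx,
            mul_left_comm]⟩
  · exact ⟨0, zero_mem _, 0, by simp, by rw [smul_zero]; exact zero_mem _, fun l _ =>
      ⟨0, zero_mem _, by rw [map_zero, LinearMap.zero_apply, mul_zero]⟩⟩
  · rintro _ _ ⟨m, hm, z, rfl, h1, h2⟩ ⟨m', hm', z', rfl, h1', h2'⟩
    refine ⟨m + m', add_mem hm hm', z + z', by abel, by rw [smul_add]; exact add_mem h1 h1', ?_⟩
    intro l hl
    obtain ⟨a, ha, hx⟩ := h2 l hl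
    obtain ⟨b, hb, hy⟩ := h2' l hl
    exact ⟨a + b, add_mem ha hb, by rw [map_add, LinearMap.add_apply, hx, hy, mul_add]⟩
  · rintro c hc _ ⟨m, hm, z, rfl, h1, h2⟩
    refine ⟨c • m, rk_lat_smul hc hm, c • z, smul_add _ _ _, by
      rw [smul_comm]; exact rk_lat_smul hc h1, ?_⟩
    intro l hl
    obtain ⟨a, ha, hx⟩ := h2 l hl
    exact ⟨c * a, mul_mem hc ha, by
      rw [map_smul, LinearMap.smul_apply, hx, smul_eq_mul, mul_left_comm]⟩

lemma rk_le_rho [FiniteDimensional K V] {v : HeightOneSpectrum (𝓞 K)}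
    (Φ : LinearMap.BilinForm K V)
    {L : Submodule (𝓞 K) V} (hL : IsZLat L) {π : 𝓞 K} (hπ0 : π ≠ 0) (hπ : π ∈ v.asIdeal)
    {t : 𝓞 K} (ht : t ∉ v.asIdeal) (htp : ∀ a ∈ v.asIdeal, ∃ b, t * a = π * b) :
    rkSet v Φ π (latCompletion v L : Set _) ⊆
      (latCompletion v (rhoK Φ v.asIdeal L) : Set _) := by
  have hπK : algebraMap (𝓞 K) K π ≠ 0 := by
    rwa [ne_eq, map_eq_zero_iff _ (FaithfulSMul.algebraMap_injective (𝓞 K) K)]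
  set ϖ := algebraMap K (v.adicCompletion K) (algebraMap (𝓞 K) K π) with hϖ
  have hϖ0 : ϖ ≠ 0 := by simpa only [hϖ, ne_eq, map_eq_zero] using hπK
  have hϖint : ϖ ∈ v.adicCompletionIntegers K := rk_coe_int v π
  have hsub : ∀ x ∈ latCompletion v L, x ∈ latCompletion v (rhoK Φ v.asIdeal L) := by
    intro x hx
    exact Submodule.span_mono (Set.image_mono (SetLike.coe_subset_coe.2 le_sup_left)) hx
  rintro _ ⟨m, hm, z, rfl, h1, h2⟩
  refine add_mem (hsub m hm) ?_
  obtain ⟨n, e, he⟩ := rk_basis hL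
  obtain ⟨d, hd0, hd⟩ := rk_denom hL.1 (fun i => Φ (e i))
  set D : v.adicCompletion K := algebraMap K (v.adicCompletion K) (algebraMap (𝓞 K) K d) with hD
  have hDint : D ∈ v.adicCompletionIntegers K := rk_coe_int v d
  have hD0 : D ≠ 0 := by
    simp only [hD, ne_eq, map_eq_zero]
    rwa [map_eq_zero_iff _ (FaithfulSMul.algebraMap_injective (𝓞 K) K)]
  let B := Algebra.TensorProduct.basis (v.adicCompletion K) e
  choose c a ha hca using fun i => rk_approx v (B.repr z i) (ϖ * D) (mul_ne_zero hϖ0 hD0)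
  obtain ⟨y, hy⟩ : ∃ y, y = ∑ i, c i • e i := ⟨_, rfl⟩
  obtain ⟨w, hw⟩ : ∃ w, w = ∑ i, (a i * (ϖ * D)) • ((1 : v.adicCompletion K) ⊗ₜ[K] e i) :=
    ⟨_, rfl⟩
  have hz : z = (1 : v.adicCompletion K) ⊗ₜ[K] y + w := by
    rw [← B.sum_repr z, hy, hw, TensorProduct.tmul_sum, ← Finset.sum_add_distrib]
    refine Finset.sum_congr rfl fun i _ => ?_
    rw [hca i, rk_tmul_smul, ← add_smul, Algebra.TensorProduct.basis_apply, mul_comm (a i)]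
  have hwL : w ∈ latCompletion v L := by
    rw [hw]
    exact sum_mem fun i _ => rk_lat_smul (mul_mem (ha i) (mul_mem hϖint hDint)) (rk_lat_of (he i))
  have hwΦ : ∀ l ∈ L, ∃ b ∈ v.adicCompletionIntegers K,
      Φ.baseChange (v.adicCompletion K) w ((1 : v.adicCompletion K) ⊗ₜ[K] l) = ϖ * b := by
    intro l hl
    refine ⟨∑ i, a i * (D * algebraMap K (v.adicCompletion K) (Φ (e i) l)), ?_, ?_⟩
    · refine sum_mem fun i _ => mul_mem (ha i) ?_
      obtain ⟨r, hr⟩ := hd l hl i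
      rw [hD, ← map_mul, ← hr]
      exact rk_coe_int v r
    · rw [hw, map_sum, LinearMap.sum_apply, Finset.mul_sum]
      refine Finset.sum_congr rfl fun i _ => ?_
      rw [map_smul, LinearMap.smul_apply, rk_bc, smul_eq_mul]
      ring
  have hy1 : (algebraMap (𝓞 K) K π) • y ∈ rkLoc v L := by
    apply rk_loc_of_lat hL
    have : (1 : v.adicCompletion K) ⊗ₜ[K] ((algebraMap (𝓞 K) K π) • y) = ϖ • z - ϖ • w := by
      rw [rk_tmul_smul, hz, smul_add, add_sub_cancel_right]
    rw [this]
    exact sub_mem h1 (rk_lat_smul hϖint hwL)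
  obtain ⟨s, hs, hsy⟩ := hy1
  obtain ⟨s', hs', hsy'⟩ := rk_unit_denom (v := v) hL.1 (Φ ((algebraMap (𝓞 K) K π)⁻¹ • y)) (by
    intro l hl
    obtain ⟨b, hb, hbl⟩ := h2 _ (rk_lat_of hl)
    obtain ⟨b', hb', hbl'⟩ := hwΦ l hl
    have h3 : algebraMap K (v.adicCompletion K) (Φ y l) = ϖ * (b - b') := by
      rw [← rk_bc, mul_sub, ← hbl, ← hbl', hz, map_add, LinearMap.add_apply,
        add_sub_cancel_right]
    rw [map_smul, LinearMap.smul_apply, smul_eq_mul, map_mul, h3, map_inv₀, ← hϖ,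
      inv_mul_cancel_left₀ hϖ0]
    exact sub_mem hb hb')
  rw [hz]
  refine add_mem ?_ (hsub w hwL)
  have hsst : s * s' * t ∉ v.asIdeal := fun h =>
    (v.isPrime.mem_or_mem h).elim (fun h => (v.isPrime.mem_or_mem h).elim hs hs') ht
  refine rk_lat_of_smul hsst (Submodule.mem_sup_right ⟨?_, ?_⟩)
  · have h3 : (s * s' * t) • y =
        s' • (algebraMap (𝓞 K) K t / algebraMap (𝓞 K) K π) • (s • (algebraMap (𝓞 K) K π • y)) := by
      simp only [rk_smul_def, smul_smul, map_mul]
      congr 1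
      field_simp
    rw [h3]
    refine Submodule.smul_mem _ _ (Submodule.subset_span ⟨_, ?_, _, hsy, rfl⟩)
    show _ ∈ (v.asIdeal : FractionalIdeal (𝓞 K)⁰ K)⁻¹
    rw [FractionalIdeal.mem_inv_iff (FractionalIdeal.coeIdeal_ne_zero.2 v.ne_bot)]
    intro q hq
    obtain ⟨q, hq', rfl⟩ := (FractionalIdeal.mem_coeIdeal _).1 hq
    obtain ⟨b, hb⟩ := htp q hq'
    refine (FractionalIdeal.mem_one_iff _).2 ⟨b, ?_⟩
    have := congrArg (algebraMap (𝓞 K) K) hb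
    rw [map_mul, map_mul] at this
    field_simp
    rw [this, mul_comm]
  · have h3 : (s * s' * t) • y =
        (s * t) • (algebraMap (𝓞 K) K π) • (s' • ((algebraMap (𝓞 K) K π)⁻¹ • y)) := by
      simp only [rk_smul_def, smul_smul, map_mul]
      congr 1
      field_simp
    rw [h3]
    refine Submodule.smul_mem _ _ (Submodule.subset_span
      ⟨_, FractionalIdeal.mem_coeIdeal_of_mem _ hπ, _, ?_, rfl⟩)
    intro l hl
    rw [rk_smul_def, map_smul, LinearMap.smul_apply, smul_eq_mul]
    exact hsy' l hl

lemma rk_smulLat_map {I : Submodule (𝓞 K) K} {N N' : Submodule (𝓞 K) V} (g : V ≃ₗ[K] V)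
    (h : ∀ x ∈ N, g x ∈ N') {x : V} (hx : x ∈ smulLatK I N) : g x ∈ smulLatK I N' := by
  induction hx using Submodule.span_induction with
  | mem x hx =>
    obtain ⟨a, ha, w, hw, rfl⟩ := hx
    exact Submodule.subset_span ⟨a, ha, g w, h w hw, (map_smul g a w).symm⟩
  | zero => rw [map_zero]; exact zero_mem _
  | add x y _ _ hx hy => rw [map_add]; exact add_mem hx hy
  | smul c x _ hx =>
    rw [rk_smul_def, map_smul, ← rk_smul_def]; exact Submodule.smul_mem _ _ hx

lemma rk_rho_map (Φ : LinearMap.BilinForm K V) (p : Ideal (𝓞 K))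
    {L L' : Submodule (𝓞 K) V} (g : V ≃ₗ[K] V) (hg : ∀ x y, Φ (g x) (g y) = Φ x y)
    (h : ∀ x ∈ L, g x ∈ L') (h' : ∀ x ∈ L', g.symm x ∈ L) {x : V} (hx : x ∈ rhoK Φ p L) :
    g x ∈ rhoK Φ p L' := by
  obtain ⟨l, hl, z, ⟨hz1, hz2⟩, rfl⟩ := Submodule.mem_sup.1 hx
  rw [map_add]
  refine add_mem (Submodule.mem_sup_left (h l hl)) (Submodule.mem_sup_right
    ⟨rk_smulLat_map g h hz1, rk_smulLat_map g ?_ hz2⟩)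
  intro w hw l hl
  rw [← g.apply_symm_apply l, hg]
  exact hw _ (h' l hl)

end helpers

theorem rhoK_preserves_genus_and_isometry
    [FiniteDimensional K V]
    (Φ : LinearMap.BilinForm K V)
    (hsymm : ∀ x y : V, Φ x y = Φ y x)
    (hnd : ∀ x : V, (∀ y : V, Φ x y = 0) → x = 0)
    (L L' : Submodule (𝓞 K) V) (hL : IsZLat L) (hL' : IsZLat L')
    (p : Ideal (𝓞 K)) (hp : p.IsMaximal) :
    (SameGenus Φ (fun _ : Fin 1 => L) (fun _ : Fin 1 => L') →
      SameGenus Φ (fun _ : Fin 1 => rhoK Φ p L) (fun _ : Fin 1 => rhoK Φ p L')) ∧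
    (IsIsom Φ (fun _ : Fin 1 => L) (fun _ : Fin 1 => L') →
      IsIsom Φ (fun _ : Fin 1 => rhoK Φ p L) (fun _ : Fin 1 => rhoK Φ p L')) := by
  have hp0 : p ≠ ⊥ := fun h => by
    subst h
    exact Ring.ne_bot_of_isMaximal_of_not_isField hp (RingOfIntegers.not_isField K) rfl
  refine ⟨fun h v => ?_, ?_⟩
  · obtain ⟨g, hg, hgL⟩ := h v
    refine ⟨g, hg, fun i => ?_⟩
    have hgL := hgL i
    simp only at hgL ⊢
    by_cases hv : v.asIdeal = p
    · subst hv
      obtain ⟨π, hπ0, hπ, hmax, t, ht, htp⟩ := rk_unif v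
      rw [Set.Subset.antisymm (rk_rho_le Φ L hπ0 hπ hmax) (rk_le_rho Φ hL hπ0 hπ ht htp),
        Set.Subset.antisymm (rk_rho_le Φ L' hπ0 hπ hmax) (rk_le_rho Φ hL' hπ0 hπ ht htp)]
      exact rkSet_image g hg hgL
    · rw [rk_rho_of_ne Φ hp0 hp hv, rk_rho_of_ne Φ hp0 hp hv]
      exact hgL
  · rintro ⟨g, hg, hgL⟩
    refine ⟨g, hg, fun i => ?_⟩
    have hgL := hgL i
    simp only at hgL ⊢
    have h1 : ∀ x ∈ L, g x ∈ L' := fun x hx => by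
      have : g x ∈ (L' : Set V) := hgL ▸ ⟨x, hx, rfl⟩
      exact this
    have h2 : ∀ x ∈ L', g.symm x ∈ L := fun x hx => by
      have : x ∈ ⇑g '' (L : Set V) := by rw [hgL]; exact hx
      obtain ⟨y, hy, rfl⟩ := this
      rw [g.symm_apply_apply]; exact hy
    have hg' : ∀ x y, Φ (g.symm x) (g.symm y) = Φ x y := fun x y => by
      rw [← hg, g.apply_symm_apply, g.apply_symm_apply]
    apply Set.Subset.antisymm
    · rintro _ ⟨x, hx, rfl⟩
      exact rk_rho_map Φ p g hg h1 h2 hx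
    · intro x hx
      exact ⟨g.symm x, rk_rho_map Φ p g.symm hg' h2 (by simpa using h1) hx,
        g.apply_symm_apply x⟩
end
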